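/- arXiv:1510.00728 — 7 statements merged into one kernel-verified Lean document; each statement's English description precedes it below -/
import Mathlib

section
/- Semi-conjugacy of representations to Homeo_ℤ(ℝ) is symmetric: let Γ be a group and ρ, ρ' : Γ → Homeo_ℤ(ℝ) group homomorphisms. If there exists a monotone map h : ℝ → ℝ with h(ρ(γ)(x)) = ρ'(γ)(h(x)) for all γ ∈ Γ and x ∈ ℝ, then there exists a monotone map h' : ℝ → ℝ with h'(ρ'(γ)(x)) = ρ(γ)(h'(x)) for all γ ∈ Γ and x ∈ ℝ. -/
open CircleDeg1Lift

namespace CircleDeg1Lift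

theorem nonempty_setOf_apply_le (h : CircleDeg1Lift) (y : ℝ) : {x | h x ≤ y}.Nonempty :=
  (h.tendsto_atBot.eventually (Filter.eventually_le_atBot y)).exists

theorem bddAbove_setOf_apply_le (h : CircleDeg1Lift) (y : ℝ) : BddAbove {x | h x ≤ y} := by
  obtain ⟨b, hb⟩ := (h.tendsto_atTop.eventually (Filter.eventually_gt_atTop y)).exists
  exact ⟨b, fun x hx => le_of_not_gt fun hbx => (hb.trans_le (h.mono hbx.le)).not_ge hx⟩

theorem sSup_setOf_apply_le_of_semiconj (h : CircleDeg1Lift) (e e' : ℝ ≃o ℝ)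
    (he : Function.Semiconj h e e') (y : ℝ) :
    sSup {x | h x ≤ e' y} = e (sSup {x | h x ≤ y}) := by
  rw [e.map_csSup' (h.nonempty_setOf_apply_le y) (h.bddAbove_setOf_apply_le y)]
  congr 1
  ext x
  rw [e.image_eq_preimage_symm, Set.mem_preimage, Set.mem_ofPred_eq, Set.mem_ofPred_eq,
    ← e'.le_iff_le (y := y), ← he.eq, e.apply_symm_apply]

/-- The upper generalized inverse `y ↦ sup {x | h x ≤ y}` of a monotone degree one map. -/
noncomputable def upperInverse (h : CircleDeg1Lift) : CircleDeg1Lift where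
  toFun y := sSup {x | h x ≤ y}
  monotone' y z hyz := csSup_le_csSup (h.bddAbove_setOf_apply_le z) (h.nonempty_setOf_apply_le y)
    fun _ hx => le_trans hx hyz
  map_add_one' y := h.sSup_setOf_apply_le_of_semiconj (OrderIso.addRight 1) (OrderIso.addRight 1)
    h.map_add_one y

theorem semiconj_upperInverse (h : CircleDeg1Lift) (f g : CircleDeg1Liftˣ)
    (hfg : Function.Semiconj h f g) : Function.Semiconj h.upperInverse g f :=
  h.sSup_setOf_apply_le_of_semiconj (toOrderIso f) (toOrderIso g) hfg

end CircleDeg1Lift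

/-- Semi-conjugacy of representations to `Homeo_ℤ(ℝ) = CircleDeg1Liftˣ` is symmetric:
if a monotone map (`CircleDeg1Lift`) `h` semi-conjugates `ρ` to `ρ'`, then some monotone
map `h'` semi-conjugates `ρ'` to `ρ`. -/
theorem semiconjugacy_symm {Γ : Type*} [Group Γ]
    (ρ ρ' : Γ →* CircleDeg1Liftˣ)
    (h : CircleDeg1Lift)
    (hh : ∀ (γ : Γ) (x : ℝ), h ((ρ γ : CircleDeg1Lift) x) = (ρ' γ : CircleDeg1Lift) (h x)) :
    ∃ h' : CircleDeg1Lift,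
      ∀ (γ : Γ) (x : ℝ), h' ((ρ' γ : CircleDeg1Lift) x) = (ρ γ : CircleDeg1Lift) (h' x) :=
  ⟨h.upperInverse, fun γ => h.semiconj_upperInverse (ρ γ) (ρ' γ) (hh γ)⟩
end

section
/- Uniqueness of the rotation quasimorphism: let r : Homeo_ℤ(ℝ) → ℝ be a function such that (i) there exists D ≥ 0 with |r(f∘g) − r(f) − r(g)| ≤ D for all f, g ∈ Homeo_ℤ(ℝ); (ii) r restricts to a homomorphism on every cyclic subgroup, i.e. r(fⁿ) = n·r(f) for all f ∈ Homeo_ℤ(ℝ) and n ∈ ℤ; and (iii) r(T₁) = 1, where T₁ is the translation x ↦ x + 1. Then r(f) = τ(f) for every f ∈ Homeo_ℤ(ℝ). -/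
open CircleDeg1Lift

/-- A real number all of whose natural multiples are uniformly bounded is zero. -/
theorem eq_zero_of_forall_nat_mul_abs_le {a C : ℝ} (h : ∀ n : ℕ, n * |a| ≤ C) : a = 0 := by
  by_contra ha
  obtain ⟨n, hn⟩ := exists_nat_gt (C / |a|)
  have hpos : 0 < |a| := abs_pos.mpr ha
  rw [div_lt_iff₀ hpos] at hn
  exact absurd (h n) (not_le.mpr hn)

/-- A homogeneous quasimorphism is a real function on a group which is additive up to a bounded
error `D` and restricts to a homomorphism on every cyclic subgroup. -/
structure IsHomogeneousQuasimorphism {G : Type*} [Group G] (ρ : G → ℝ) (D : ℝ) : Prop where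
  abs_mul_sub_le : ∀ f g, |ρ (f * g) - ρ f - ρ g| ≤ D
  map_zpow : ∀ (f : G) (n : ℤ), ρ (f ^ n) = n * ρ f

namespace IsHomogeneousQuasimorphism

variable {G H : Type*} [Group G] [Group H] {ρ : G → ℝ} {D : ℝ}

theorem comp (h : IsHomogeneousQuasimorphism ρ D) (φ : H →* G) :
    IsHomogeneousQuasimorphism (fun x => ρ (φ x)) D where
  abs_mul_sub_le f g := by simpa using h.abs_mul_sub_le (φ f) (φ g)
  map_zpow f n := by simpa using h.map_zpow (φ f) n

theorem map_pow (h : IsHomogeneousQuasimorphism ρ D) (f : G) (n : ℕ) :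
    ρ (f ^ n) = n * ρ f := by
  simpa using h.map_zpow f n

theorem map_inv (h : IsHomogeneousQuasimorphism ρ D) (f : G) : ρ f⁻¹ = -ρ f := by
  simpa using h.map_zpow f (-1)

theorem map_conj (h : IsHomogeneousQuasimorphism ρ D) (f g : G) :
    ρ (g * f * g⁻¹) = ρ f := by
  refine sub_eq_zero.mp (eq_zero_of_forall_nat_mul_abs_le (C := 2 * D) fun n => ?_)
  have h₁ := abs_le.mp (h.abs_mul_sub_le (g * f ^ n) g⁻¹)
  have h₂ := abs_le.mp (h.abs_mul_sub_le g (f ^ n))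
  rw [← conj_pow, h.map_pow, h.map_inv] at h₁
  rw [h.map_pow f] at h₂
  rw [← abs_of_nonneg (Nat.cast_nonneg (α := ℝ) n), ← abs_mul, abs_le]
  constructor <;> linarith [h₁.1, h₁.2, h₂.1, h₂.2]

theorem eq_zero_of_bounded (h : IsHomogeneousQuasimorphism ρ D) {C : ℝ} (hC : ∀ f, |ρ f| ≤ C)
    (f : G) : ρ f = 0 := by
  refine eq_zero_of_forall_nat_mul_abs_le (C := C) fun n => ?_
  simpa [h.map_pow, abs_mul] using hC (f ^ n)

end IsHomogeneousQuasimorphism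

section RealLine

theorem add_natCast_le_pow_apply {k : ℝ ≃o ℝ} (hk : ∀ x, x + 1 ≤ k x) (n : ℕ) (x : ℝ) :
    x + n ≤ (k ^ n) x := by
  induction n with
  | zero => simp
  | succ n ih =>
    rw [pow_succ', RelIso.mul_apply]
    push_cast
    linarith [hk ((k ^ n) x)]

theorem strictMono_zpow_apply {k : ℝ ≃o ℝ} (hk : ∀ x, x + 1 ≤ k x) (x : ℝ) :
    StrictMono fun n : ℤ => (k ^ n) x := by
  refine strictMono_int_of_lt_succ fun n => ?_
  rw [zpow_add_one, RelIso.mul_apply]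
  exact (k ^ n).strictMono (by linarith [hk x])

theorem exists_zpow_apply_le_lt {k : ℝ ≃o ℝ} (hk : ∀ x, x + 1 ≤ k x) (z : ℝ) :
    ∃ n : ℤ, (k ^ n) 0 ≤ z ∧ z < (k ^ (n + 1)) 0 := by
  have hlow : ∃ n : ℤ, (k ^ n) 0 ≤ z := by
    obtain ⟨n, hn⟩ := exists_nat_ge (-z)
    refine ⟨-n, ?_⟩
    have h := add_natCast_le_pow_apply hk n z
    rw [← (k ^ (n : ℤ)).le_iff_le, ← RelIso.mul_apply, ← zpow_add]
    simp only [add_neg_cancel, zpow_zero, RelIso.one_apply, zpow_natCast]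
    linarith
  have hupp : ∃ b : ℤ, ∀ n : ℤ, (k ^ n) 0 ≤ z → n ≤ b := by
    obtain ⟨n, hn⟩ := exists_nat_ge z
    refine ⟨n, fun m hm => (strictMono_zpow_apply hk 0).le_iff_le.mp (hm.trans ?_)⟩
    have h := add_natCast_le_pow_apply hk n 0
    simp only [zpow_natCast]
    linarith
  obtain ⟨n, hn, hmax⟩ := Int.exists_greatest_of_bdd hupp hlow
  refine ⟨n, hn, ?_⟩
  by_contra! hlt
  have := hmax _ hlt
  omega

/-- An order automorphism of the line moving every point up by at least one is conjugate to the
unit translation. -/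
theorem exists_semiconj_addRight_one {k : ℝ ≃o ℝ} (hk : ∀ x, x + 1 ≤ k x) :
    ∃ h : ℝ ≃o ℝ, k = h * OrderIso.addRight 1 * h⁻¹ := by
  have hk0 : 0 < k 0 := by linarith [hk 0]
  let F : ℝ → ℝ := fun x => (k ^ ⌊x⌋) (Int.fract x * k 0)
  have hlt : ∀ x, F x < (k ^ (⌊x⌋ + 1)) 0 := fun x => by
    rw [zpow_add_one, RelIso.mul_apply]
    exact (k ^ ⌊x⌋).strictMono (by nlinarith [Int.fract_lt_one x])
  have hle : ∀ x, (k ^ ⌊x⌋) 0 ≤ F x := fun x =>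
    (k ^ ⌊x⌋).monotone (mul_nonneg (Int.fract_nonneg x) hk0.le)
  have hmono : StrictMono F := fun x y hxy => by
    rcases (Int.floor_mono hxy.le).eq_or_lt with h | h
    · have : Int.fract x < Int.fract y := by
        simp only [Int.fract, h]; linarith
      change (k ^ ⌊x⌋) _ < (k ^ ⌊y⌋) _
      rw [h]
      exact (k ^ ⌊y⌋).strictMono (by nlinarith)
    · exact (hlt x).trans_le (((strictMono_zpow_apply hk 0).monotone h).trans (hle y))
  have hsurj : Function.Surjective F := fun z => by
    obtain ⟨n, h₁, h₂⟩ := exists_zpow_apply_le_lt hk z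
    obtain ⟨w, rfl⟩ := (k ^ n).surjective z
    rw [(k ^ n).le_iff_le] at h₁
    rw [zpow_add_one, RelIso.mul_apply, (k ^ n).lt_iff_lt] at h₂
    have hmem : w / k 0 ∈ Set.Ico (0 : ℝ) 1 := ⟨by positivity, (div_lt_one hk0).mpr h₂⟩
    have hfloor : ⌊w / k 0⌋ = 0 := Int.floor_eq_zero_iff.mpr hmem
    refine ⟨n + w / k 0, ?_⟩
    simp only [F, Int.floor_intCast_add, Int.fract_intCast_add, hfloor, add_zero,
      Int.fract_eq_self.mpr hmem]
    rw [div_mul_cancel₀ _ hk0.ne']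
  refine ⟨hmono.orderIsoOfSurjective F hsurj, ?_⟩
  rw [eq_mul_inv_iff_mul_eq]
  ext x
  change k (F x) = F (x + 1)
  simp only [F, Int.floor_add_one, Int.fract_add_one]
  rw [add_comm, zpow_one_add, RelIso.mul_apply]

theorem exists_orderIso_eq_max (k l : ℝ ≃o ℝ) : ∃ s : ℝ ≃o ℝ, ∀ x, s x = max (k x) (l x) := by
  have hmono : StrictMono fun x => max (k x) (l x) := fun x y hxy =>
    max_lt_max (k.strictMono hxy) (l.strictMono hxy)
  have hsurj : Function.Surjective fun x => max (k x) (l x) :=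
    (k.continuous.max l.continuous).surjective
      (Filter.tendsto_atTop_mono (fun x => le_max_left _ _) k.tendsto_atTop)
      (by
        rw [Filter.tendsto_atBot]
        intro b
        filter_upwards [Filter.tendsto_atBot.mp k.tendsto_atBot b,
          Filter.tendsto_atBot.mp l.tendsto_atBot b] with x h₁ h₂ using max_le h₁ h₂)
  exact ⟨hmono.orderIsoOfSurjective _ hsurj, fun x => rfl⟩

/-- Homogeneous quasimorphisms vanish on the group of order automorphisms of the line. -/
theorem IsHomogeneousQuasimorphism.orderIso_real_eq_zero {ρ : (ℝ ≃o ℝ) → ℝ} {D : ℝ}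
    (h : IsHomogeneousQuasimorphism ρ D) (k : ℝ ≃o ℝ) : ρ k = 0 := by
  have key : ∀ l : ℝ ≃o ℝ, (∀ x, x + 1 ≤ l x) → ρ l = ρ (OrderIso.addRight 1) := fun l hl => by
    obtain ⟨g, rfl⟩ := exists_semiconj_addRight_one hl
    exact h.map_conj _ _
  have hone : ρ (OrderIso.addRight 1) = 0 := by
    have h₁ := key (OrderIso.addRight 1 ^ 2) fun x => by
      simp [pow_two, RelIso.mul_apply]
    rw [h.map_pow] at h₁
    push_cast at h₁
    linarith
  refine h.eq_zero_of_bounded (C := D) (fun l => ?_) k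
  obtain ⟨s, hs⟩ := exists_orderIso_eq_max (l⁻¹ * OrderIso.addRight 1) (OrderIso.addRight 1)
  have h₁ : ρ s = 0 := hone ▸ key s fun x => by
    rw [hs]; exact le_max_right _ _
  have h₂ : ρ (l * s) = 0 := hone ▸ key (l * s) fun x => by
    have h₃ : l ((l⁻¹ * OrderIso.addRight 1 : ℝ ≃o ℝ) x) ≤ l (s x) :=
      l.monotone (by rw [hs]; exact le_max_left _ _)
    rw [RelIso.mul_apply, RelIso.apply_inv_self] at h₃
    exact h₃
  simpa [h₁, h₂] using h.abs_mul_sub_le l s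

end RealLine

namespace CircleDeg1Lift

/-- An order isomorphism between the line and the open unit interval. -/
noncomputable def realOrderIsoIoo : ℝ ≃o Set.Ioo (0 : ℝ) 1 :=
  (orderIsoIooNegOneOne ℝ).trans
    { toFun := fun x => ⟨(x + 1) / 2, by
        have := x.2.1; have := x.2.2; constructor <;> linarith⟩
      invFun := fun x => ⟨2 * x - 1, by
        have := x.2.1; have := x.2.2; constructor <;> linarith⟩
      left_inv := fun x => Subtype.ext (by simp; ring)
      right_inv := fun x => Subtype.ext (by simp)
      map_rel_iff' := fun {a b} => by
        change ((a : ℝ) + 1) / 2 ≤ ((b : ℝ) + 1) / 2 ↔ (a : ℝ) ≤ b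
        constructor <;> intro h <;> linarith }

open Classical in
/-- The action of an order automorphism of the line on the unit interval, extended by the
identity. -/
noncomputable def unitIntervalMap (k : ℝ ≃o ℝ) (y : ℝ) : ℝ :=
  if h : y ∈ Set.Ioo (0 : ℝ) 1 then realOrderIsoIoo (k (realOrderIsoIoo.symm ⟨y, h⟩)) else y

theorem unitIntervalMap_coe (k : ℝ ≃o ℝ) (z : ℝ) :
    unitIntervalMap k (realOrderIsoIoo z) = realOrderIsoIoo (k z) := by
  simp [unitIntervalMap]

theorem unitIntervalMap_zero (k : ℝ ≃o ℝ) : unitIntervalMap k 0 = 0 := by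
  simp [unitIntervalMap]

theorem eq_zero_or_exists_realOrderIsoIoo_eq {y : ℝ} (hy : y ∈ Set.Ico (0 : ℝ) 1) :
    y = 0 ∨ ∃ z, (realOrderIsoIoo z : ℝ) = y := by
  rcases hy.1.eq_or_lt with h | h
  · exact Or.inl h.symm
  · exact Or.inr ⟨realOrderIsoIoo.symm ⟨y, h, hy.2⟩, by simp⟩

theorem unitIntervalMap_mem (k : ℝ ≃o ℝ) {y : ℝ} (hy : y ∈ Set.Ico (0 : ℝ) 1) :
    unitIntervalMap k y ∈ Set.Ico (0 : ℝ) 1 := by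
  rcases eq_zero_or_exists_realOrderIsoIoo_eq hy with rfl | ⟨z, rfl⟩
  · simp [unitIntervalMap_zero]
  · rw [unitIntervalMap_coe]
    exact Set.Ioo_subset_Ico_self (realOrderIsoIoo (k z)).2

theorem unitIntervalMap_mono (k : ℝ ≃o ℝ) {x y : ℝ} (hx : x ∈ Set.Ico (0 : ℝ) 1)
    (hy : y ∈ Set.Ico (0 : ℝ) 1) (hxy : x ≤ y) : unitIntervalMap k x ≤ unitIntervalMap k y := by
  rcases eq_zero_or_exists_realOrderIsoIoo_eq hx with rfl | ⟨z, rfl⟩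
  · rw [unitIntervalMap_zero]
    exact (unitIntervalMap_mem k hy).1
  rcases eq_zero_or_exists_realOrderIsoIoo_eq hy with rfl | ⟨w, rfl⟩
  · exact absurd hxy (not_le.mpr (realOrderIsoIoo z).2.1)
  · rw [unitIntervalMap_coe, unitIntervalMap_coe]
    rw [Subtype.coe_le_coe, realOrderIsoIoo.le_iff_le] at hxy ⊢
    exact k.monotone hxy

theorem fract_mem_Ico (x : ℝ) : Int.fract x ∈ Set.Ico (0 : ℝ) 1 :=
  ⟨Int.fract_nonneg x, Int.fract_lt_one x⟩

/-- The degree one lift fixing the integers and acting on every unit interval between consecutive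
integers by the given order automorphism of the line. -/
noncomputable def ofOrderIsoLift (k : ℝ ≃o ℝ) : CircleDeg1Lift where
  toFun x := ⌊x⌋ + unitIntervalMap k (Int.fract x)
  monotone' x y hxy := by
    rcases (Int.floor_mono hxy).eq_or_lt with h | h
    · have : Int.fract x ≤ Int.fract y := by
        simp only [Int.fract, h]; linarith
      simp only [h]
      gcongr
      exact unitIntervalMap_mono k (fract_mem_Ico x) (fract_mem_Ico y) this
    · have h₁ := (unitIntervalMap_mem k (fract_mem_Ico x)).2
      have h₂ := (unitIntervalMap_mem k (fract_mem_Ico y)).1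
      have h₃ : (⌊x⌋ : ℝ) + 1 ≤ ⌊y⌋ := by exact_mod_cast h
      linarith
  map_add_one' x := by
    simp only [Int.floor_add_one, Int.fract_add_one]
    push_cast
    ring

theorem ofOrderIsoLift_apply (k : ℝ ≃o ℝ) (x : ℝ) :
    ofOrderIsoLift k x = ⌊x⌋ + unitIntervalMap k (Int.fract x) := rfl

/-- The action of the order automorphisms of the line by degree one lifts fixing the integers. -/
noncomputable def ofOrderIso : (ℝ ≃o ℝ) →* CircleDeg1Liftˣ :=
  MonoidHom.toHomUnits
    { toFun := ofOrderIsoLift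
      map_one' := by
        ext x
        rw [ofOrderIsoLift_apply]
        have : unitIntervalMap 1 (Int.fract x) = Int.fract x := by
          rcases eq_zero_or_exists_realOrderIsoIoo_eq (fract_mem_Ico x) with h | ⟨z, h⟩
          · rw [h, unitIntervalMap_zero]
          · rw [← h, unitIntervalMap_coe, RelIso.one_apply]
        rw [this, Int.floor_add_fract, coe_one, id]
      map_mul' := fun k l => by
        ext x
        have hmem := unitIntervalMap_mem l (fract_mem_Ico x)
        have hfloor : ⌊unitIntervalMap l (Int.fract x)⌋ = 0 := Int.floor_eq_zero_iff.mpr hmem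
        simp only [mul_apply, ofOrderIsoLift_apply, Int.floor_intCast_add,
          Int.fract_intCast_add, hfloor, add_zero, Int.fract_eq_self.mpr hmem]
        congr 1
        rcases eq_zero_or_exists_realOrderIsoIoo_eq (fract_mem_Ico x) with h | ⟨z, h⟩
        · simp only [h, unitIntervalMap_zero]
        · simp only [← h, unitIntervalMap_coe, RelIso.mul_apply] }

theorem ofOrderIso_apply (k : ℝ ≃o ℝ) (x : ℝ) :
    ofOrderIso k x = ⌊x⌋ + unitIntervalMap k (Int.fract x) := rfl

theorem ofOrderIso_realOrderIsoIoo (k : ℝ ≃o ℝ) (z : ℝ) :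
    ofOrderIso k (realOrderIsoIoo z) = realOrderIsoIoo (k z) := by
  have hmem : (realOrderIsoIoo z : ℝ) ∈ Set.Ico (0 : ℝ) 1 :=
    Set.Ioo_subset_Ico_self (realOrderIsoIoo z).2
  rw [ofOrderIso_apply, Int.fract_eq_self.mpr hmem, Int.floor_eq_zero_iff.mpr hmem,
    unitIntervalMap_coe, Int.cast_zero, zero_add]

theorem exists_ofOrderIso_eq {g : CircleDeg1Liftˣ} (hg : g 0 = 0) :
    ∃ k, ofOrderIso k = g := by
  have hmono : StrictMono g := (toOrderIso g).strictMono
  have hg1 : g 1 = 1 := by simpa [hg] using (g : CircleDeg1Lift).map_add_one 0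
  have hmem : ∀ y ∈ Set.Ioo (0 : ℝ) 1, g y ∈ Set.Ioo (0 : ℝ) 1 := fun y hy => by
    have h₁ := hmono hy.1
    have h₂ := hmono hy.2
    rw [hg] at h₁
    rw [hg1] at h₂
    exact ⟨h₁, h₂⟩
  let F : ℝ → ℝ := fun z =>
    realOrderIsoIoo.symm ⟨g (realOrderIsoIoo z), hmem _ (Subtype.coe_prop _)⟩
  have hF : StrictMono F := fun x y hxy =>
    realOrderIsoIoo.symm.strictMono (hmono (realOrderIsoIoo.strictMono hxy))
  have hsurj : Function.Surjective F := fun z => by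
    obtain ⟨y, hy⟩ := (toOrderIso g).surjective (realOrderIsoIoo z)
    rw [coe_toOrderIso] at hy
    have hz := (realOrderIsoIoo z).2
    rw [← hy] at hz
    have hy0 : 0 < y := hmono.lt_iff_lt.mp (by rw [hg]; exact hz.1)
    have hy1 : y < 1 := hmono.lt_iff_lt.mp (by rw [hg1]; exact hz.2)
    refine ⟨realOrderIsoIoo.symm ⟨y, hy0, hy1⟩, ?_⟩
    simp [F, hy]
  refine ⟨hF.orderIsoOfSurjective F hsurj, ?_⟩
  ext x
  rw [ofOrderIso_apply]
  have hx : g x = ⌊x⌋ + g (Int.fract x) := by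
    rw [← map_int_add, Int.floor_add_fract]
  rw [hx]
  congr 1
  rcases eq_zero_or_exists_realOrderIsoIoo_eq (fract_mem_Ico x) with h | ⟨z, h⟩
  · rw [h, unitIntervalMap_zero, hg]
  · rw [← h, unitIntervalMap_coe]
    simp [F]

/-- For every `t ∈ [0, 1)` some conjugate of an element fixing the integers maps `0` to `t`. -/
theorem exists_conj_ofOrderIso_apply_zero {t : ℝ} (ht : t ∈ Set.Ico (0 : ℝ) 1) :
    ∃ (k : ℝ ≃o ℝ) (h : CircleDeg1Liftˣ), (h * ofOrderIso k * h⁻¹ : CircleDeg1Liftˣ) 0 = t := by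
  obtain ⟨ht0, ht1⟩ := ht
  let a := realOrderIsoIoo.symm ⟨(1 - t) / 2, by constructor <;> linarith⟩
  let b := realOrderIsoIoo.symm ⟨(1 + t) / 2, by constructor <;> linarith⟩
  have ha : (realOrderIsoIoo a : ℝ) = (1 - t) / 2 := by simp [a]
  have hb : (realOrderIsoIoo b : ℝ) = (1 + t) / 2 := by simp [b]
  refine ⟨OrderIso.addRight (b - a), translate (Multiplicative.ofAdd ((t - 1) / 2)), ?_⟩
  simp only [Units.val_mul, mul_apply, translate_inv_apply, translate_apply]
  rw [show -((t - 1) / 2) + 0 = (realOrderIsoIoo a : ℝ) by rw [ha]; ring,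
    ofOrderIso_realOrderIsoIoo, OrderIso.addRight_apply, add_sub_cancel, hb]
  ring

end CircleDeg1Lift

theorem IsHomogeneousQuasimorphism.abs_le_of_map_zero_mem_Ico {r : CircleDeg1Liftˣ → ℝ} {D : ℝ}
    (h : IsHomogeneousQuasimorphism r D) {g : CircleDeg1Liftˣ} (hg : g 0 ∈ Set.Ico (0 : ℝ) 1) :
    |r g| ≤ D := by
  have hzero : ∀ k, r (ofOrderIso k) = 0 := (h.comp ofOrderIso).orderIso_real_eq_zero
  obtain ⟨k, c, hc⟩ := exists_conj_ofOrderIso_apply_zero hg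
  set u : CircleDeg1Liftˣ := c * ofOrderIso k * c⁻¹ with hu
  have hfix : (u⁻¹ * g : CircleDeg1Liftˣ) 0 = 0 := by
    rw [Units.val_mul, mul_apply, ← hc, units_inv_apply_apply]
  obtain ⟨l, hl⟩ := exists_ofOrderIso_eq hfix
  have h₁ : r u = 0 := by rw [hu, h.map_conj, hzero]
  have h₂ : r (u⁻¹ * g) = 0 := by rw [← hl, hzero]
  simpa [h₁, h₂] using h.abs_mul_sub_le u (u⁻¹ * g)

/-- Uniqueness of the rotation quasimorphism: a function `r : Homeo_ℤ(ℝ) → ℝ` that is a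
quasimorphism, is a homomorphism on cyclic subgroups, and takes the value `1` on the
translation `x ↦ x + 1`, coincides with the translation number. -/
theorem rotation_quasimorphism_unique (r : CircleDeg1Liftˣ → ℝ)
    (hquasi : ∃ D : ℝ, 0 ≤ D ∧ ∀ f g : CircleDeg1Liftˣ, |r (f * g) - r f - r g| ≤ D)
    (hpow : ∀ (f : CircleDeg1Liftˣ) (n : ℤ), r (f ^ n) = n * r f)
    (htrans : r (translate (Multiplicative.ofAdd (1 : ℝ))) = 1) :
    ∀ f : CircleDeg1Liftˣ, r f = translationNumber (f : CircleDeg1Lift) := by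
  obtain ⟨D, -, hD⟩ := hquasi
  have h : IsHomogeneousQuasimorphism r D := ⟨hD, hpow⟩
  intro f
  refine sub_eq_zero.mp (eq_zero_of_forall_nat_mul_abs_le (C := 2 * D + 2) fun n => ?_)
  set m : ℤ := ⌊(f ^ n : CircleDeg1Liftˣ) 0⌋ with hm
  set T : CircleDeg1Liftˣ := translate (Multiplicative.ofAdd (1 : ℝ)) ^ m with hT
  have hrT : r T = m := by rw [hT, hpow, htrans, mul_one]
  have hg : (T⁻¹ * f ^ n : CircleDeg1Liftˣ) 0 ∈ Set.Ico (0 : ℝ) 1 := by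
    rw [hT, translate_zpow, Units.val_mul, mul_apply, translate_inv_apply, mul_one,
      neg_add_eq_sub, hm]
    exact fract_mem_Ico _
  have h₁ := abs_le.mp (h.abs_le_of_map_zero_mem_Ico hg)
  have h₂ := abs_le.mp (hD T (T⁻¹ * f ^ n))
  rw [mul_inv_cancel_left, h.map_pow, hrT] at h₂
  have h₃ := dist_pow_map_zero_mul_translationNumber_le (f : CircleDeg1Lift) n
  rw [Real.dist_eq, ← Units.val_pow_eq_pow_val, abs_le] at h₃
  have h₄ := Int.floor_le ((f ^ n : CircleDeg1Liftˣ) 0)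
  have h₅ := Int.lt_floor_add_one ((f ^ n : CircleDeg1Liftˣ) 0)
  rw [← hm] at h₄ h₅
  rw [← abs_of_nonneg (Nat.cast_nonneg (α := ℝ) n), ← abs_mul, abs_le]
  constructor <;> linarith [h₁.1, h₁.2, h₂.1, h₂.2, h₃.1, h₃.2]
end

section
/- Let w be a positive word in n letters and let s₁, …, sₙ ∈ ℝ. The set S = { τ(w(f₁,…,fₙ)) : f₁,…,fₙ ∈ Homeo_ℤ(ℝ) with τ(fᵢ) = sᵢ for all i } is nonempty, bounded, and order-convex (for all a, b ∈ S and c ∈ ℝ with a ≤ c ≤ b, one has c ∈ S); hence S is an interval. -/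
open CircleDeg1Lift

/-- Translation number of an element of `Homeo_ℤ(ℝ) = CircleDeg1Liftˣ`. -/
noncomputable def tau (f : CircleDeg1Liftˣ) : ℝ :=
  translationNumber (f : CircleDeg1Lift)

/-- The set of translation numbers `τ(w(f₁,…,fₙ))` over all tuples `fᵢ ∈ Homeo_ℤ(ℝ)`
with `τ(fᵢ) = sᵢ`, where `w` is a (positive) word in `n` letters evaluated by
substitution. -/
def rotSet {n : ℕ} (w : FreeMonoid (Fin n)) (s : Fin n → ℝ) : Set ℝ :=
  {y | ∃ f : Fin n → CircleDeg1Liftˣ, (∀ i, tau (f i) = s i) ∧ y = tau (FreeMonoid.lift f w)}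

/-- The graph of a monotone map `F`, with the vertical segments at its jumps filled in. -/
def completedGraph (F : ℝ → ℝ) : Set (ℝ × ℝ) :=
  {p | (∀ x < p.1, F x ≤ p.2) ∧ ∀ x > p.1, p.2 ≤ F x}

theorem completedGraph_chain {F : ℝ → ℝ} {p q : ℝ × ℝ} (hp : p ∈ completedGraph F)
    (hq : q ∈ completedGraph F) : p ≤ q ∨ q ≤ p := by
  have key : ∀ {p q : ℝ × ℝ}, p ∈ completedGraph F → q ∈ completedGraph F → p.1 < q.1 →
      p ≤ q := by
    intro p q hp hq h
    obtain ⟨m, h₁, h₂⟩ := exists_between h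
    exact ⟨h.le, (hp.2 m h₁).trans (hq.1 m h₂)⟩
  rcases lt_trichotomy p.1 q.1 with h | h | h
  · exact .inl (key hp hq h)
  · exact (le_total p.2 q.2).imp (fun h' => ⟨h.le, h'⟩) fun h' => ⟨h.ge, h'⟩
  · exact .inr (key hq hp h)

theorem completedGraph_map {F : ℝ → ℝ} {f g : CircleDeg1Liftˣ} (h : Function.Semiconj F f g)
    {p : ℝ × ℝ} (hp : p ∈ completedGraph F) : (f p.1, g p.2) ∈ completedGraph F := by
  have hF : ∀ x, F x = g (F (f⁻¹ x)) := fun x => by rw [← h, units_apply_inv_apply]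
  have hs : StrictMono f := by
    rw [← coe_toOrderIso]; exact (toOrderIso f).strictMono
  refine ⟨fun x hx => ?_, fun x hx => ?_⟩ <;> rw [hF] <;> refine (g : CircleDeg1Lift).mono ?_
  · refine hp.1 _ (hs.lt_iff_lt.1 ?_)
    rwa [units_apply_inv_apply]
  · refine hp.2 _ (hs.lt_iff_lt.1 ?_)
    rwa [units_apply_inv_apply]

theorem completedGraph_add_one (F : CircleDeg1Lift) {p : ℝ × ℝ} (hp : p ∈ completedGraph F) :
    (p.1 + 1, p.2 + 1) ∈ completedGraph F := by
  refine ⟨fun x hx => ?_, fun x hx => ?_⟩ <;> have e := F.map_add_one (x - 1) <;>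
    rw [sub_add_cancel] at e <;> simp only at hx ⊢
  · linarith [hp.1 (x - 1) (by linarith)]
  · linarith [hp.2 (x - 1) (by linarith)]

/-- Every weighted average of the two coordinates maps the completed graph onto `ℝ`. -/
theorem exists_mem_completedGraph (F : CircleDeg1Lift) (t : unitInterval) (z : ℝ) :
    ∃ p ∈ completedGraph F, (1 - t : ℝ) * p.1 + t * p.2 = z := by
  obtain ⟨t, ht0, ht1⟩ := t
  simp only
  rcases ht0.eq_or_lt with rfl | ht
  · exact ⟨(z, F z), ⟨fun x hx => F.mono hx.le, fun x hx => F.mono (le_of_lt hx)⟩, by simp⟩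
  set S : Set ℝ := {a | (1 - t) * a + t * F a ≤ z} with hS
  have hF0 := abs_le.1 (le_refl |F 0|)
  have hne : S.Nonempty := by
    refine ⟨z - |F 0| - 1, ?_⟩
    have := F.map_le_of_map_zero (z - |F 0| - 1)
    have := Int.ceil_lt_add_one (z - |F 0| - 1)
    have h : F (z - |F 0| - 1) ≤ z := by linarith
    have : 0 ≤ |F 0| := abs_nonneg _
    simp only [hS, Set.mem_ofPred_eq]
    nlinarith
  have hbdd : BddAbove S := by
    refine ⟨z + |F 0| + 1, fun a ha => ?_⟩
    by_contra! hlt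
    have := F.le_map_of_map_zero a
    have := Int.lt_floor_add_one a
    have h : z < F a := by linarith
    have : 0 ≤ |F 0| := abs_nonneg _
    simp only [hS, Set.mem_ofPred_eq] at ha
    nlinarith
  set a := sSup S
  refine ⟨(a, (z - (1 - t) * a) / t), ⟨fun x hx => ?_, fun x hx => ?_⟩, ?_⟩
  · simp only at hx ⊢
    rw [le_div_iff₀ ht]
    refine le_of_forall_pos_le_add fun ε hε => ?_
    obtain ⟨b, hb, hlt⟩ := exists_lt_of_lt_csSup hne (max_lt hx (sub_lt_self a hε))
    have h₁ := F.mono ((le_max_left _ _).trans hlt.le)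
    have h₂ := (le_max_right _ _).trans hlt.le
    simp only [hS, Set.mem_ofPred_eq] at hb
    nlinarith
  · simp only [gt_iff_lt] at hx ⊢
    rw [div_le_iff₀ ht]
    refine le_of_forall_pos_le_add fun ε hε => ?_
    have hm := notMem_of_csSup_lt (lt_min hx (lt_add_of_pos_right a hε)) hbdd
    have h₁ := F.mono (min_le_left x (a + ε))
    have h₂ := min_le_right x (a + ε)
    simp only [hS, Set.mem_ofPred_eq, not_le] at hm
    nlinarith
  · field_simp
    ring

theorem weighted_map_le {F : ℝ → ℝ} (f g : CircleDeg1Lift) (t : unitInterval) {p q : ℝ × ℝ}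
    (hp : p ∈ completedGraph F) (hq : q ∈ completedGraph F)
    (h : (1 - t : ℝ) * p.1 + t * p.2 ≤ (1 - t) * q.1 + t * q.2) :
    (1 - t : ℝ) * f p.1 + t * g p.2 ≤ (1 - t) * f q.1 + t * g q.2 := by
  obtain ⟨t, ht0, ht1⟩ := t
  simp only at h ⊢
  have ht1' := sub_nonneg.2 ht1
  rcases completedGraph_chain hp hq with hle | hle
  · exact add_le_add (mul_le_mul_of_nonneg_left (f.mono hle.1) ht1')
      (mul_le_mul_of_nonneg_left (g.mono hle.2) ht0)
  · have h₁ := mul_le_mul_of_nonneg_left hle.1 ht1'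
    have h₂ := mul_le_mul_of_nonneg_left hle.2 ht0
    have e₁ : (1 - t) * p.1 = (1 - t) * q.1 := by linarith
    have e₂ : t * p.2 = t * q.2 := by linarith
    refine le_of_eq (congrArg₂ _ ?_ ?_)
    · rcases mul_eq_mul_left_iff.1 e₁ with e | e <;> simp [e]
    · rcases mul_eq_mul_left_iff.1 e₂ with e | e <;> simp [e]

/-- The map `(1 - t) a + t b ↦ (1 - t) f a + t g b`, where `(a, b)` ranges over the completed
graph of `F`. -/
noncomputable def interpolate (F f g : CircleDeg1Lift) (t : unitInterval) : CircleDeg1Lift where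
  toFun z := (1 - t : ℝ) * f (exists_mem_completedGraph F t z).choose.1 +
    t * g (exists_mem_completedGraph F t z).choose.2
  monotone' z z' h := by
    have h₁ := (exists_mem_completedGraph F t z).choose_spec
    have h₂ := (exists_mem_completedGraph F t z').choose_spec
    exact weighted_map_le f g t h₁.1 h₂.1 (by rwa [h₁.2, h₂.2])
  map_add_one' z := by
    have h₁ := (exists_mem_completedGraph F t z).choose_spec
    have h₂ := (exists_mem_completedGraph F t (z + 1)).choose_spec
    set p := (exists_mem_completedGraph F t z).choose
    set q := (exists_mem_completedGraph F t (z + 1)).choose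
    have h₃ := completedGraph_add_one F h₁.1
    have e : (1 - t : ℝ) * q.1 + t * q.2 = (1 - t) * (p.1 + 1) + t * (p.2 + 1) := by
      linarith [h₁.2, h₂.2]
    have := (weighted_map_le f g t h₂.1 h₃ e.le).antisymm (weighted_map_le f g t h₃ h₂.1 e.ge)
    simp only [CircleDeg1Lift.map_add_one] at this
    linarith

theorem interpolate_apply (F f g : CircleDeg1Lift) (t : unitInterval) {p : ℝ × ℝ}
    (hp : p ∈ completedGraph F) :
    interpolate F f g t ((1 - t) * p.1 + t * p.2) = (1 - t) * f p.1 + t * g p.2 := by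
  have h := (exists_mem_completedGraph F t ((1 - t) * p.1 + t * p.2)).choose_spec
  exact (weighted_map_le f g t h.1 hp h.2.le).antisymm (weighted_map_le f g t hp h.1 h.2.ge)

theorem interpolate_mul_interpolate_inv {F : CircleDeg1Lift} {f g : CircleDeg1Liftˣ}
    (h : Function.Semiconj F f g) (t : unitInterval) :
    interpolate F f⁻¹.1 g⁻¹.1 t * interpolate F f g t = 1 := by
  ext z
  obtain ⟨p, hp, rfl⟩ := exists_mem_completedGraph F t z
  rw [CircleDeg1Lift.mul_apply, interpolate_apply _ _ _ _ hp,
    interpolate_apply _ _ _ _ (completedGraph_map h hp)]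
  simp

theorem semiconj_units_inv {F : ℝ → ℝ} {f g : CircleDeg1Liftˣ} (h : Function.Semiconj F f g) :
    Function.Semiconj F (f⁻¹ : CircleDeg1Liftˣ) (g⁻¹ : CircleDeg1Liftˣ) := fun x => by
  conv_rhs => rw [← units_apply_inv_apply f x, h, units_inv_apply_apply]

/-- `interpolate` as a path of homeomorphisms, when `F` semiconjugates `f` to `g`. -/
noncomputable def interpolateUnits {F : CircleDeg1Lift} {f g : CircleDeg1Liftˣ}
    (h : Function.Semiconj F f g) (t : unitInterval) : CircleDeg1Liftˣ where
  val := interpolate F f g t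
  inv := interpolate F f⁻¹.1 g⁻¹.1 t
  val_inv := by simpa using interpolate_mul_interpolate_inv (semiconj_units_inv h) t
  inv_val := interpolate_mul_interpolate_inv h t

theorem continuous_units (f : CircleDeg1Liftˣ) : Continuous f := by
  rw [← coe_toOrderIso]; exact (toOrderIso f).continuous

theorem tau_interpolateUnits {F : CircleDeg1Lift} {f g : CircleDeg1Liftˣ}
    (h : Function.Semiconj F f g) (hfg : tau f = tau g) (t : unitInterval) :
    tau (interpolateUnits h t) = tau f := by
  have key : ∀ (n : ℕ) {p : ℝ × ℝ}, p ∈ completedGraph F →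
      (interpolate F f g t ^ n) ((1 - t) * p.1 + t * p.2) =
        (1 - t) * ((f : CircleDeg1Lift) ^ n) p.1 + t * ((g : CircleDeg1Lift) ^ n) p.2 := by
    intro n
    induction n with
    | zero => simp
    | succ n ih =>
      intro p hp
      simp only [pow_succ, CircleDeg1Lift.mul_apply]
      rw [interpolate_apply _ _ _ _ hp, ih (completedGraph_map h hp)]
  obtain ⟨p, hp, -⟩ := exists_mem_completedGraph F t 0
  have lim := ((tendsto_translationNumber (f : CircleDeg1Lift) p.1).const_mul (1 - t : ℝ)).add
    ((tendsto_translationNumber (g : CircleDeg1Lift) p.2).const_mul (t : ℝ))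
  refine tendsto_nhds_unique
    (tendsto_translationNumber (interpolate F f g t) ((1 - t) * p.1 + t * p.2)) ?_
  convert lim using 2 with n
  · rw [key n hp]; ring
  · unfold tau at *; rw [← hfg]; ring

theorem continuous_interpolateUnits {F : CircleDeg1Lift} {f g : CircleDeg1Liftˣ}
    (h : Function.Semiconj F f g) :
    Continuous fun q : unitInterval × ℝ => interpolateUnits h q.1 q.2 := by
  have happ : ∀ (t : unitInterval) {p : ℝ × ℝ}, p ∈ completedGraph F →
    interpolateUnits h t ((1 - t) * p.1 + t * p.2) = (1 - t) * f p.1 + t * g p.2 :=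
    fun t p hp => interpolate_apply F f g t hp
  have hcont : ∀ a b : ℝ, Continuous fun q : unitInterval × ℝ => (1 - q.1 : ℝ) * a + q.1 * b :=
    fun a b => by fun_prop
  refine continuous_iff_continuousAt.2 fun ⟨t₀, z₀⟩ =>
    tendsto_order.2 ⟨fun c hc => ?_, fun c hc => ?_⟩
  · obtain ⟨z₁, hz, hc₁⟩ := (((continuous_units (interpolateUnits h t₀)).continuousAt.eventually
      (lt_mem_nhds hc)).filter_mono nhdsWithin_le_nhds |>.and
        (self_mem_nhdsWithin (s := Set.Iio z₀))).exists.imp fun _ => And.symm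
    obtain ⟨p, hp, rfl⟩ := exists_mem_completedGraph F t₀ z₁
    rw [happ t₀ hp] at hc₁
    filter_upwards [(hcont p.1 p.2).continuousAt.eventually_lt continuous_snd.continuousAt hz,
      (hcont (f p.1) (g p.2)).continuousAt.eventually (lt_mem_nhds hc₁)] with q hq₁ hq₂
    rw [← happ q.1 hp] at hq₂
    exact hq₂.trans_le ((interpolateUnits h q.1 : CircleDeg1Lift).mono hq₁.le)
  · obtain ⟨z₁, hz, hc₁⟩ := (((continuous_units (interpolateUnits h t₀)).continuousAt.eventually
      (gt_mem_nhds hc)).filter_mono nhdsWithin_le_nhds |>.and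
        (self_mem_nhdsWithin (s := Set.Ioi z₀))).exists.imp fun _ => And.symm
    obtain ⟨p, hp, rfl⟩ := exists_mem_completedGraph F t₀ z₁
    rw [happ t₀ hp] at hc₁
    filter_upwards [continuous_snd.continuousAt.eventually_lt (hcont p.1 p.2).continuousAt hz,
      (hcont (f p.1) (g p.2)).continuousAt.eventually (gt_mem_nhds hc₁)] with q hq₁ hq₂
    rw [← happ q.1 hp] at hq₂
    exact ((interpolateUnits h q.1 : CircleDeg1Lift).mono hq₁.le).trans_lt hq₂

/-- Homeomorphisms with equal translation numbers are joined by a path along which the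
translation number is constant. -/
theorem exists_path_tau_eq {f g : CircleDeg1Liftˣ} (hfg : tau f = tau g) :
    ∃ φ : unitInterval → CircleDeg1Liftˣ, φ 0 = f ∧ φ 1 = g ∧ (∀ t, tau (φ t) = tau f) ∧
      Continuous fun q : unitInterval × ℝ => φ q.1 q.2 := by
  obtain ⟨F, h⟩ := units_semiconj_of_translationNumber_eq hfg
  refine ⟨interpolateUnits h, ?_, ?_, tau_interpolateUnits h hfg, continuous_interpolateUnits h⟩
  · ext z
    obtain ⟨p, hp, rfl⟩ := exists_mem_completedGraph F 0 z
    exact (interpolate_apply F f g 0 hp).trans (by simp)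
  · ext z
    obtain ⟨p, hp, rfl⟩ := exists_mem_completedGraph F 1 z
    exact (interpolate_apply F f g 1 hp).trans (by simp)

theorem continuous_pow_apply {X : Type*} [TopologicalSpace X] {φ : X → CircleDeg1Lift}
    (h : Continuous fun q : X × ℝ => φ q.1 q.2) (n : ℕ) :
    Continuous fun q : X × ℝ => (φ q.1 ^ n) q.2 := by
  induction n with
  | zero => simpa using continuous_snd
  | succ n ih =>
    simp only [pow_succ, CircleDeg1Lift.mul_apply]
    exact ih.comp (continuous_fst.prodMk h)

theorem continuous_translationNumber {X : Type*} [TopologicalSpace X] {φ : X → CircleDeg1Lift}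
    (h : Continuous fun q : X × ℝ => φ q.1 q.2) :
    Continuous fun x => translationNumber (φ x) := by
  have hlim : TendstoUniformly (fun (n : ℕ) x => (φ x ^ n) 0 / n)
      (fun x => translationNumber (φ x)) Filter.atTop := by
    rw [Metric.tendstoUniformly_iff]
    intro ε hε
    obtain ⟨N, hN⟩ := exists_nat_gt (1 / ε)
    filter_upwards [Filter.eventually_ge_atTop N, Filter.eventually_gt_atTop 0] with n hn hn0 x
    have hn0' : (0 : ℝ) < n := by exact_mod_cast hn0
    have hb := dist_pow_map_zero_mul_translationNumber_le (φ x) n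
    have hlt : 1 / ε < n := hN.trans_le (by exact_mod_cast hn)
    have e : (φ x ^ n) 0 / n - translationNumber (φ x) =
        ((φ x ^ n) 0 - n * translationNumber (φ x)) / n := by field_simp
    rw [dist_comm, Real.dist_eq, e, abs_div, abs_of_pos hn0', div_lt_iff₀ hn0']
    rw [Real.dist_eq] at hb
    rw [div_lt_iff₀ hε] at hlt
    linarith
  refine hlim.continuous (Filter.Frequently.of_forall fun n => ?_)
  exact ((continuous_pow_apply h n).comp (continuous_id.prodMk continuous_const)).div_const _

theorem continuous_lift_apply {X ι : Type*} [TopologicalSpace X] {φ : ι → X → CircleDeg1Liftˣ}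
    (h : ∀ i, Continuous fun q : X × ℝ => φ i q.1 q.2) (w : FreeMonoid ι) :
    Continuous fun q : X × ℝ => FreeMonoid.lift (fun i => φ i q.1) w q.2 := by
  induction w using FreeMonoid.inductionOn' with
  | one => simpa using continuous_snd
  | of_mul i w ih =>
    simp only [map_mul, FreeMonoid.lift_eval_of, Units.val_mul, CircleDeg1Lift.mul_apply]
    exact (h i).comp (continuous_fst.prodMk ih)

theorem abs_units_apply_sub_le (f : CircleDeg1Liftˣ) (x : ℝ) : |f x - x| ≤ |tau f| + 1 := by
  have h₁ := map_lt_add_translationNumber_add_one (f : CircleDeg1Lift) x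
  have h₂ := map_lt_add_translationNumber_add_one (f⁻¹ : CircleDeg1Liftˣ) (f x)
  rw [units_inv_apply_apply, translationNumber_units_inv] at h₂
  have h₃ := abs_le.1 (le_refl |tau f|)
  unfold tau at *
  exact abs_le.2 ⟨by linarith, by linarith⟩

theorem exists_abs_lift_apply_sub_le {ι : Type*} (w : FreeMonoid ι) (s : ι → ℝ) :
    ∃ C, ∀ f : ι → CircleDeg1Liftˣ, (∀ i, tau (f i) = s i) →
      ∀ x, |FreeMonoid.lift f w x - x| ≤ C := by
  induction w using FreeMonoid.inductionOn' with
  | one => exact ⟨0, fun f _ x => by simp⟩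
  | of_mul i w ih =>
    obtain ⟨C, hC⟩ := ih
    refine ⟨|s i| + 1 + C, fun f hf x => ?_⟩
    have h₁ := abs_units_apply_sub_le (f i) (FreeMonoid.lift f w x)
    rw [hf] at h₁
    simp only [map_mul, FreeMonoid.lift_eval_of, Units.val_mul, CircleDeg1Lift.mul_apply]
    exact (abs_sub_le _ _ _).trans (add_le_add h₁ (hC f hf x))

/-- For a nonempty positive word `w` in `n` letters and prescribed rotation numbers
`s₁,…,sₙ`, the set of possible values of `τ(w(f₁,…,fₙ))` is nonempty, bounded and
order-convex; hence it is an interval. -/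
theorem rotSet_nonempty_bounded_ordConnected {n : ℕ} (w : FreeMonoid (Fin n))
    (hw : w ≠ 1) (s : Fin n → ℝ) :
    (rotSet w s).Nonempty ∧ BddAbove (rotSet w s) ∧ BddBelow (rotSet w s) ∧
      ∀ a ∈ rotSet w s, ∀ b ∈ rotSet w s, ∀ c : ℝ, a ≤ c → c ≤ b → c ∈ rotSet w s := by
  obtain ⟨C, hC⟩ := exists_abs_lift_apply_sub_le w s
  refine ⟨⟨_, fun i => translate (Multiplicative.ofAdd (s i)),
    fun i => translationNumber_translate _, rfl⟩, ⟨C, ?_⟩, ⟨-C, ?_⟩, ?_⟩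
  · rintro _ ⟨f, hf, rfl⟩
    exact translationNumber_le_of_le_add _ fun x => by linarith [(abs_le.1 (hC f hf x)).2]
  · rintro _ ⟨f, hf, rfl⟩
    exact le_translationNumber_of_add_le _ fun x => by linarith [(abs_le.1 (hC f hf x)).1]
  · rintro _ ⟨f, hf, rfl⟩ _ ⟨g, hg, rfl⟩ c hac hcb
    choose φ hφ₀ hφ₁ hφ hcont using fun i => exists_path_tau_eq ((hf i).trans (hg i).symm)
    have hτ := continuous_translationNumber
      (φ := fun t => (FreeMonoid.lift (fun i => φ i t) w : CircleDeg1Liftˣ))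
      (continuous_lift_apply hcont w)
    obtain ⟨t, ht⟩ := mem_range_of_exists_le_of_exists_ge hτ (c := c)
      ⟨0, by simp only [hφ₀]; exact hac⟩ ⟨1, by simp only [hφ₁]; exact hcb⟩
    exact ⟨fun i => φ i t, fun i => (hφ i t).trans (hf i), ht.symm⟩
end

section
/- Lower semi-continuity of R_w: let w be a positive word in n letters. For any sequences sᵢ(k) → sᵢ (as k → ∞, for each i = 1,…,n), one has R_w(s₁,…,sₙ) ≥ limsup_{k→∞} R_w(s₁(k),…,sₙ(k)). -/
open CircleDeg1Lift

/-- `R_w(s₁,…,sₙ) = sup { τ(w(f₁,…,fₙ)) : τ(fᵢ) = sᵢ }`. -/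
noncomputable def Rw {n : ℕ} (w : FreeMonoid (Fin n)) (s : Fin n → ℝ) : ℝ :=
  sSup (rotSet w s)

open Filter Topology

namespace CircleDeg1Lift

/-- The map `x ↦ max_{y ∈ S} (y + φ (x - y))` built from a lift `φ`. -/
noncomputable def supConj (S : Finset ℝ) (hS : S.Nonempty) (φ : CircleDeg1Lift) :
    CircleDeg1Lift where
  toFun x := S.sup' hS fun y => y + φ (x - y)
  monotone' x x' h := Finset.sup'_mono_fun fun y _ => by
    have := φ.monotone (sub_le_sub_right h y)
    linarith
  map_add_one' x := by
    have h : ∀ y, y + φ (x + 1 - y) = y + φ (x - y) + 1 := fun y => by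
      rw [show x + 1 - y = x - y + 1 by ring, φ.map_add_one]
      ring
    simp only [h]
    exact (Finset.apply_sup'_eq_sup'_comp hS (fun t : ℝ => t + 1) fun a b =>
      (max_add_add_right a b 1).symm).symm

theorem supConj_apply (S : Finset ℝ) (hS : S.Nonempty) (φ : CircleDeg1Lift) (x : ℝ) :
    supConj S hS φ x = S.sup' hS fun y => y + φ (x - y) := rfl

/-- The integer part, as a lift of a degree one map. -/
noncomputable def floorLift : CircleDeg1Lift where
  toFun x := (⌊x⌋ : ℝ)
  monotone' _ _ h := Int.cast_le.2 (Int.floor_mono h)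
  map_add_one' x := by simp

theorem floorLift_apply (x : ℝ) : floorLift x = (⌊x⌋ : ℝ) := rfl

theorem floor_add_fract_pow_strictMono (n : ℕ) :
    StrictMono fun x : ℝ => (⌊x⌋ : ℝ) + Int.fract x ^ (n + 1) := by
  intro x y h
  rcases (Int.floor_mono h.le).eq_or_lt with he | hl
  · have h' : Int.fract x < Int.fract y := by
      rw [Int.fract, Int.fract, he]
      linarith
    have := pow_lt_pow_left₀ h' (Int.fract_nonneg x) n.succ_ne_zero
    simp only [he]
    simpa using this
  · have h1 : (⌊x⌋ : ℝ) + 1 ≤ ⌊y⌋ := by exact_mod_cast hl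
    have h2 : Int.fract x ^ (n + 1) < 1 :=
      pow_lt_one₀ (Int.fract_nonneg x) (Int.fract_lt_one x) n.succ_ne_zero
    have h3 : 0 ≤ Int.fract y ^ (n + 1) := pow_nonneg (Int.fract_nonneg y) _
    simp only
    linarith

/-- The lift `x ↦ ⌊x⌋ + {x}ⁿ⁺¹`; these homeomorphisms decrease to the integer part. -/
noncomputable def fractPowLift (n : ℕ) : CircleDeg1Lift where
  toFun x := (⌊x⌋ : ℝ) + Int.fract x ^ (n + 1)
  monotone' := (floor_add_fract_pow_strictMono n).monotone
  map_add_one' x := by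
    simp
    ring

theorem fractPowLift_apply (n : ℕ) (x : ℝ) :
    fractPowLift n x = (⌊x⌋ : ℝ) + Int.fract x ^ (n + 1) := rfl

theorem continuous_fractPowLift (n : ℕ) : Continuous (fractPowLift n) := by
  have h : Continuous ((fun t : ℝ => t ^ (n + 1) - t) ∘ Int.fract) :=
    ContinuousOn.comp_fract'' (by fun_prop) (by simp)
  refine (continuous_id.add h).congr fun x => ?_
  simp only [fractPowLift_apply, Pi.add_apply, id_eq, Function.comp_apply]
  linarith [Int.floor_add_fract x]

theorem tendsto_fractPowLift (x : ℝ) :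
    Tendsto (fun n => fractPowLift n x) atTop (𝓝 (floorLift x)) := by
  have h := (tendsto_add_atTop_iff_nat 1).2
    (tendsto_pow_atTop_nhds_zero_of_lt_one (Int.fract_nonneg x) (Int.fract_lt_one x))
  simpa [fractPowLift_apply, floorLift_apply] using h.const_add (⌊x⌋ : ℝ)

theorem isUnit_supConj (S : Finset ℝ) (hS : S.Nonempty) {φ : CircleDeg1Lift}
    (hc : Continuous φ) (hm : StrictMono φ) : IsUnit (supConj S hS φ) := by
  refine isUnit_iff_bijective.2 ⟨StrictMono.injective fun x x' h => ?_, ?_⟩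
  · rw [supConj_apply, Finset.sup'_lt_iff]
    intro y hy
    refine lt_of_lt_of_le ?_ (Finset.le_sup' (fun y => y + φ (x' - y)) hy)
    have := hm (sub_lt_sub_right h y)
    linarith
  · refine (continuous_iff_surjective _).1 ?_
    exact Continuous.finset_sup'_apply hS fun y _ => by fun_prop

theorem eventually_floorLift_eq (x : ℝ) : ∀ᶠ u in 𝓝[≥] x, floorLift u = floorLift x := by
  filter_upwards [Ico_mem_nhdsGE (Int.lt_floor_add_one x)] with u hu
  rw [floorLift_apply, floorLift_apply, Int.cast_inj, Int.floor_eq_iff]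
  exact ⟨(Int.floor_le x).trans hu.1, hu.2⟩

theorem eventually_supConj_floorLift_eq (S : Finset ℝ) (hS : S.Nonempty) (x : ℝ) :
    ∀ᶠ u in 𝓝[≥] x, supConj S hS floorLift u = supConj S hS floorLift x := by
  have h : ∀ᶠ u in 𝓝[≥] x, ∀ y ∈ S, floorLift (u - y) = floorLift (x - y) := by
    refine (Finset.eventually_all S).2 fun y _ => ?_
    have ht : Tendsto (fun u => u - y) (𝓝[≥] x) (𝓝[≥] (x - y)) :=
      ((continuous_sub_right y).continuousWithinAt).tendsto_nhdsWithin fun u hu =>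
        sub_le_sub_right hu y
    exact ht.eventually (eventually_floorLift_eq (x - y))
  filter_upwards [h] with u hu
  rw [supConj_apply, supConj_apply]
  exact Finset.sup'_congr hS rfl fun y hy => by rw [hu y hy]

theorem supConj_floorLift_le (S : Finset ℝ) (hS : S.Nonempty) (x : ℝ) :
    supConj S hS floorLift x ≤ x := by
  rw [supConj_apply]
  refine Finset.sup'_le hS _ fun y _ => ?_
  rw [floorLift_apply]
  linarith [Int.floor_le (x - y)]

theorem exists_supConj_floorLift_eq (S : Finset ℝ) (hS : S.Nonempty) (x : ℝ) :
    ∃ y ∈ S, ∃ n : ℤ, supConj S hS floorLift x = y + n := by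
  obtain ⟨y, hy, h⟩ := Finset.exists_mem_eq_sup' hS fun y => y + floorLift (x - y)
  exact ⟨y, hy, ⌊x - y⌋, h⟩

theorem le_supConj_of_mem {S : Finset ℝ} (hS : S.Nonempty) {φ : CircleDeg1Lift}
    (h0 : φ 0 = 0) {x : ℝ} (hx : x ∈ S) : x ≤ supConj S hS φ x := by
  have := Finset.le_sup' (fun y => y + φ (x - y)) hx
  rwa [sub_self, h0, add_zero] at this

theorem tendsto_supConj_fractPowLift (S : Finset ℝ) (hS : S.Nonempty) (x : ℝ) :
    Tendsto (fun n => supConj S hS (fractPowLift n) x) atTop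
      (𝓝 (supConj S hS floorLift x)) := by
  simp only [supConj_apply]
  exact Tendsto.finset_sup'_nhds_apply hS fun y _ => (tendsto_fractPowLift (x - y)).const_add y

/-- If every value of `F` lies in `S + ℤ`, then `F` has a periodic point, of period at most `#S`. -/
theorem exists_pow_eq_add_int (S : Finset ℝ) (F : CircleDeg1Lift)
    (hF : ∀ x, ∃ y ∈ S, ∃ n : ℤ, F x = y + n) :
    ∃ z : ℝ, ∃ b : ℕ, ∃ a : ℤ, 0 < b ∧ b ≤ S.card ∧ (F ^ b) z = z + a := by
  choose y hy n hn using hF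
  obtain ⟨i, hi, j, hj, hij, he⟩ := Finset.exists_ne_map_eq_of_card_lt_of_maps_to
    (s := Finset.range (S.card + 1)) (t := S) (by simp)
    (f := fun i => y ((F ^ i) 0)) fun i _ => hy _
  wlog hlt : i < j generalizing i j
  · exact this j hj i hi hij.symm he.symm (by omega)
  simp only [Finset.mem_range] at hi hj
  refine ⟨F ((F ^ i) 0), j - i, n ((F ^ j) 0) - n ((F ^ i) 0), by omega, by omega, ?_⟩
  have h1 : (F ^ (j - i)) (F ((F ^ i) 0)) = F ((F ^ j) 0) := by
    rw [← mul_apply, ← mul_apply, ← mul_apply, mul_assoc, ← pow_succ', ← pow_succ', ← pow_add]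
    congr 2
    omega
  rw [h1, hn, hn, he]
  push_cast
  ring

/-- If `F` is constant to the right of each point and `G n → F` pointwise, then iterates of `G n`
are eventually not much larger than those of `F` slightly to the right of a given point. -/
theorem exists_gt_eventually_pow_le {F : CircleDeg1Lift} {G : ℕ → CircleDeg1Lift}
    (hF : ∀ x, ∀ᶠ u in 𝓝[≥] x, F u = F x)
    (hG : ∀ x, Tendsto (fun n => G n x) atTop (𝓝 (F x))) (b : ℕ) (z : ℝ) :
    ∃ u > z, ∀ t > (F ^ (b + 1)) z, ∀ᶠ n in atTop, ((G n) ^ (b + 1)) u ≤ t := by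
  induction b generalizing z with
  | zero =>
    obtain ⟨u, hu, hz⟩ := (((hF z).filter_mono (nhdsWithin_mono z Set.Ioi_subset_Ici_self)).and
      self_mem_nhdsWithin).exists
    refine ⟨u, hz, fun t ht => ?_⟩
    simp only [zero_add, pow_one] at ht ⊢
    exact ((hG u).eventually_lt_const (hu ▸ ht)).mono fun _ h => h.le
  | succ b ih =>
    obtain ⟨u, hu, hz⟩ := (((hF z).filter_mono (nhdsWithin_mono z Set.Ioi_subset_Ici_self)).and
      self_mem_nhdsWithin).exists
    obtain ⟨u', hu', h⟩ := ih (F z)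
    refine ⟨u, hz, fun t ht => ?_⟩
    rw [pow_succ, mul_apply] at ht
    filter_upwards [h t ht, (hG u).eventually_lt_const (hu ▸ hu' : F u < u')] with n h1 h2
    rw [pow_succ, mul_apply]
    exact ((G n ^ (b + 1)).mono h2.le).trans h1

/-- The values of a homeomorphism on a finite set `S` can be attained by a homeomorphism whose
translation number is at most a fraction `a / b ≤ τ f` with `b ≤ #S`. -/
theorem exists_unit_translationNumber_le (f : CircleDeg1Liftˣ) (S : Finset ℝ)
    (hS : S.Nonempty) :
    ∃ g : CircleDeg1Liftˣ, ∃ b : ℕ, ∃ a : ℤ, 0 < b ∧ b ≤ S.card ∧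
      (a : ℝ) ≤ b * translationNumber f ∧ b * translationNumber g ≤ a ∧
      ∀ x ∈ S, f x ≤ g x := by
  set P := supConj S hS floorLift
  have hfc : Continuous f := (continuous_iff_surjective _).2 (toOrderIso f).surjective
  have hH : ∀ n, IsUnit (supConj S hS (fractPowLift n)) := fun n =>
    isUnit_supConj S hS (continuous_fractPowLift n) (floor_add_fract_pow_strictMono n)
  choose H hH using hH
  obtain ⟨z, b, a, hb, hbS, hz⟩ := exists_pow_eq_add_int S (P * f)
    fun x => exists_supConj_floorLift_eq S hS (f x)
  obtain ⟨u, hu, h⟩ := exists_gt_eventually_pow_le (F := P * f) (G := fun n => ↑(H n) * ↑f)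
    (fun x => by
      have ht : Tendsto f (𝓝[≥] x) (𝓝[≥] (f x)) :=
        hfc.continuousWithinAt.tendsto_nhdsWithin fun u hu => CircleDeg1Lift.monotone _ hu
      exact ht.eventually (eventually_supConj_floorLift_eq S hS (f x)))
    (fun x => by
      simpa only [hH, mul_apply] using tendsto_supConj_fractPowLift S hS (f x)) (b - 1) z
  rw [Nat.sub_add_cancel hb] at h
  obtain ⟨n, hn⟩ := (h (u + a) (by rw [hz]; linarith [hu])).exists
  refine ⟨f * H n, b, a, hb, hbS, ?_, ?_, fun x hx => ?_⟩
  · rw [← translationNumber_pow]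
    refine (le_translationNumber_of_add_int_le _ hz.ge).trans
      (translationNumber_mono (pow_mono (fun x => ?_) b))
    exact supConj_floorLift_le S hS (f x)
  · have hconj : translationNumber (f * H n : CircleDeg1Liftˣ)
        = translationNumber (↑(H n) * ↑f : CircleDeg1Lift) := by
      refine translationNumber_eq_of_semiconjBy (f := ((H n : CircleDeg1Liftˣ) : CircleDeg1Lift)) ?_
      simp [SemiconjBy, mul_assoc]
    rw [hconj, ← translationNumber_pow]
    exact translationNumber_le_of_le_add_int _ hn
  · rw [Units.val_mul, mul_apply, hH]
    exact CircleDeg1Lift.mono _ (le_supConj_of_mem hS (by simp [fractPowLift_apply]) hx)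

theorem continuous_translate_mul_pow_apply (g : CircleDeg1Liftˣ) (b : ℕ) (x : ℝ) :
    Continuous fun t : ℝ => (((translate (Multiplicative.ofAdd t) * g : CircleDeg1Liftˣ) :
      CircleDeg1Lift) ^ b) x := by
  have hgc : Continuous g := (continuous_iff_surjective _).2 (toOrderIso g).surjective
  induction b with
  | zero => simpa using continuous_const
  | succ b ih =>
    simp only [pow_succ', mul_apply, Units.val_mul, translate_apply] at ih ⊢
    exact continuous_id.add (hgc.comp ih)

theorem continuous_translationNumber_translate_mul (g : CircleDeg1Liftˣ) :
    Continuous fun t : ℝ =>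
      translationNumber (translate (Multiplicative.ofAdd t) * g : CircleDeg1Liftˣ) := by
  refine continuous_iff_continuousAt.2 fun t => tendsto_order.2 ⟨fun c hc => ?_, fun c hc => ?_⟩
  · obtain ⟨r, hcr, hr⟩ := exists_rat_btwn hc
    have hd : (0 : ℝ) < r.den := by exact_mod_cast r.den_pos
    rw [Rat.cast_def, div_lt_iff₀' hd, ← translationNumber_pow] at hr
    have h := lt_map_of_int_lt_translationNumber _ hr 0
    filter_upwards [(continuous_translate_mul_pow_apply g r.den 0).continuousAt.eventually_const_lt
      h] with t' ht'
    have := le_translationNumber_of_add_int_le _ ht'.le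
    rw [translationNumber_pow, ← div_le_iff₀' hd, ← Rat.cast_def] at this
    exact hcr.trans_le this
  · obtain ⟨r, hr, hcr⟩ := exists_rat_btwn hc
    have hd : (0 : ℝ) < r.den := by exact_mod_cast r.den_pos
    rw [Rat.cast_def, lt_div_iff₀' hd, ← translationNumber_pow] at hr
    have h := map_lt_of_translationNumber_lt_int _ hr 0
    filter_upwards [(continuous_translate_mul_pow_apply g r.den 0).continuousAt.eventually_lt_const
      h] with t' ht'
    have := translationNumber_le_of_le_add_int _ ht'.le
    rw [translationNumber_pow, ← le_div_iff₀' hd, ← Rat.cast_def] at this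
    exact this.trans_lt hcr

theorem exists_unit_ge_translationNumber_eq (g : CircleDeg1Liftˣ) {s : ℝ}
    (hs : translationNumber g ≤ s) :
    ∃ g' : CircleDeg1Liftˣ, translationNumber g' = s ∧ ∀ x, g x ≤ g' x := by
  set T := max 0 (s - g 0 + 1)
  have hT : s ≤ translationNumber (translate (Multiplicative.ofAdd T) * g : CircleDeg1Liftˣ) := by
    have h := dist_map_zero_translationNumber_le
      ((translate (Multiplicative.ofAdd T) * g : CircleDeg1Liftˣ) : CircleDeg1Lift)
    rw [Real.dist_eq, abs_le] at h
    have h0 : ((translate (Multiplicative.ofAdd T) * g : CircleDeg1Liftˣ) : CircleDeg1Lift) 0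
      = T + g 0 := rfl
    have := le_max_right 0 (s - g 0 + 1)
    linarith [h.2]
  obtain ⟨t, ht, h⟩ := intermediate_value_Icc (le_max_left 0 (s - g 0 + 1))
    (continuous_translationNumber_translate_mul g).continuousOn ⟨by simpa using hs, hT⟩
  refine ⟨_, h, fun x => ?_⟩
  rw [Units.val_mul, mul_apply, translate_apply]
  linarith [ht.1]

/-- If no fraction with denominator at most `#S` lies in `(s, τ f]`, some homeomorphism with
translation number `s` dominates `f` on `S`. -/
theorem exists_unit_translationNumber_eq_of_finset (f : CircleDeg1Liftˣ) (S : Finset ℝ)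
    (hS : S.Nonempty) {s : ℝ}
    (h : ∀ b : ℕ, b ≤ S.card → ⌊b * translationNumber f⌋ ≤ ⌊b * s⌋) :
    ∃ g : CircleDeg1Liftˣ, translationNumber g = s ∧ ∀ x ∈ S, f x ≤ g x := by
  obtain ⟨g, b, a, hb, hbS, haf, hga, hfg⟩ := exists_unit_translationNumber_le f S hS
  have has : (a : ℝ) ≤ b * s := Int.le_floor.1 ((Int.le_floor.2 haf).trans (h b hbS))
  have hb' : (0 : ℝ) < b := by exact_mod_cast hb
  obtain ⟨g', hg', hle⟩ := exists_unit_ge_translationNumber_eq g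
    (le_of_mul_le_mul_left (hga.trans has) hb')
  exact ⟨g', hg', fun x hx => (hfg x hx).trans (hle x)⟩

/-- A lower bound for a positive word evaluated at `0` only involves finitely many values of the
letters, in number bounded in terms of the word. -/
theorem exists_finset_lift_apply_zero_le {n : ℕ} (v : FreeMonoid (Fin n)) :
    ∃ m : ℕ, ∀ f : Fin n → CircleDeg1Liftˣ, ∃ S : Finset ℝ, S.Nonempty ∧ S.card ≤ m ∧
      ∀ g : Fin n → CircleDeg1Liftˣ, (∀ i, ∀ x ∈ S, f i x ≤ g i x) →
        FreeMonoid.lift f v 0 ≤ FreeMonoid.lift g v 0 := by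
  induction v using FreeMonoid.inductionOn' with
  | one => exact ⟨1, fun f => ⟨{0}, by simp, by simp, fun g _ => by simp⟩⟩
  | of_mul i v ih =>
    obtain ⟨m, ih⟩ := ih
    refine ⟨m + 1, fun f => ?_⟩
    obtain ⟨S, -, hm, h⟩ := ih f
    refine ⟨insert (FreeMonoid.lift f v 0) S, by simp, (Finset.card_insert_le _ _).trans
      (by omega), fun g hg => ?_⟩
    simp only [map_mul, FreeMonoid.lift_eval_of, Units.val_mul, mul_apply]
    exact (hg i _ (Finset.mem_insert_self _ _)).trans (CircleDeg1Lift.mono _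
      (h g fun i x hx => hg i x (Finset.mem_insert_of_mem hx)))

theorem exists_lift_displacement_bound {n : ℕ} (v : FreeMonoid (Fin n)) :
    ∃ C : ℝ, ∀ (f : Fin n → CircleDeg1Liftˣ) (M : ℝ),
      ((∀ i x, f i x ≤ x + M) → ∀ x, FreeMonoid.lift f v x ≤ x + C * M) ∧
      ((∀ i x, x + M ≤ f i x) → ∀ x, x + C * M ≤ FreeMonoid.lift f v x) := by
  induction v using FreeMonoid.inductionOn' with
  | one => exact ⟨0, fun f M => by simp⟩
  | of_mul i v ih =>
    obtain ⟨C, ih⟩ := ih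
    refine ⟨C + 1, fun f M => ⟨fun h x => ?_, fun h x => ?_⟩⟩ <;>
      simp only [map_mul, FreeMonoid.lift_eval_of, Units.val_mul, mul_apply]
    · linarith [h i (FreeMonoid.lift f v x), (ih f M).1 h x]
    · linarith [h i (FreeMonoid.lift f v x), (ih f M).2 h x]

end CircleDeg1Lift

theorem bddAbove_rotSet {n : ℕ} (w : FreeMonoid (Fin n)) (s : Fin n → ℝ) :
    BddAbove (rotSet w s) := by
  obtain ⟨C, hC⟩ := exists_lift_displacement_bound w
  refine ⟨C * (∑ i, |s i| + 1), ?_⟩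
  rintro _ ⟨f, hf, rfl⟩
  refine translationNumber_le_of_le_add _ ((hC f _).1 fun i x => ?_)
  have h1 := map_lt_add_translationNumber_add_one (f i) x
  have h2 : |s i| ≤ ∑ i, |s i| :=
    Finset.single_le_sum (f := fun i => |s i|) (fun _ _ => abs_nonneg _) (Finset.mem_univ i)
  have h3 : translationNumber (f i) = s i := hf i
  linarith [le_abs_self (s i)]

theorem lift_translate_mem_rotSet {n : ℕ} (w : FreeMonoid (Fin n)) (s : Fin n → ℝ) :
    tau (FreeMonoid.lift (fun i => translate (Multiplicative.ofAdd (s i))) w) ∈ rotSet w s :=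
  ⟨_, fun i => translationNumber_translate (s i), rfl⟩

theorem exists_le_Rw {n : ℕ} (w : FreeMonoid (Fin n)) (M : ℝ) :
    ∃ B : ℝ, ∀ s : Fin n → ℝ, (∀ i, M ≤ s i) → B ≤ Rw w s := by
  obtain ⟨C, hC⟩ := exists_lift_displacement_bound w
  refine ⟨C * M, fun s hs => ?_⟩
  refine le_trans ?_ (le_csSup (bddAbove_rotSet w s) (lift_translate_mem_rotSet w s))
  refine le_translationNumber_of_add_le _ ((hC _ M).2 fun i x => ?_)
  rw [translate_apply]
  linarith [hs i]

/-- For every fraction `r > R_w(s)`, a bound `R_w(s') ≤ r` holds as soon as no fraction of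
denominator at most `m` separates some `sᵢ` from a larger `s'ᵢ`. -/
theorem exists_Rw_le_of_floor_le {n : ℕ} (w : FreeMonoid (Fin n)) (s : Fin n → ℝ) {r : ℚ}
    (hr : Rw w s < r) :
    ∃ m : ℕ, ∀ s' : Fin n → ℝ, (∀ i, ∀ b : ℕ, b ≤ m → ⌊b * s' i⌋ ≤ ⌊b * s i⌋) →
      Rw w s' ≤ r := by
  obtain ⟨m, hm⟩ := exists_finset_lift_apply_zero_le (w ^ r.den)
  have hd : (0 : ℝ) < r.den := by exact_mod_cast r.den_pos
  refine ⟨m, fun s' hs' => csSup_le ⟨_, lift_translate_mem_rotSet w s'⟩ ?_⟩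
  rintro _ ⟨f, hf, rfl⟩
  by_contra! hlt
  obtain ⟨S, hS, hcard, h⟩ := hm f
  have hg : ∀ i, ∃ g : CircleDeg1Liftˣ, translationNumber g = s i ∧ ∀ x ∈ S, f i x ≤ g x :=
    fun i => exists_unit_translationNumber_eq_of_finset (f i) S hS fun b hb => by
      rw [show translationNumber (f i) = s' i from hf i]
      exact hs' i b (hb.trans hcard)
  choose g hg hfg using hg
  have h1 := h g hfg
  rw [map_pow, map_pow, Units.val_pow_eq_pow_val, Units.val_pow_eq_pow_val] at h1
  rw [tau, Rat.cast_def, div_lt_iff₀' hd, ← translationNumber_pow] at hlt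
  have h2 := le_translationNumber_of_add_int_le _
    ((lt_map_of_int_lt_translationNumber _ hlt 0).le.trans h1)
  rw [translationNumber_pow, ← div_le_iff₀' hd, ← Rat.cast_def] at h2
  exact (h2.trans (le_csSup (bddAbove_rotSet w s) ⟨g, hg, rfl⟩)).not_gt hr

/-- Lower semi-continuity of `R_w`: if `sᵢ(k) → sᵢ` for each `i`, then
`R_w(s₁,…,sₙ) ≥ limsup_k R_w(s₁(k),…,sₙ(k))`. -/
theorem Rw_lower_semicontinuous {n : ℕ} (w : FreeMonoid (Fin n)) (hw : w ≠ 1)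
    (s : Fin n → ℝ) (sk : ℕ → Fin n → ℝ)
    (hconv : ∀ i, Filter.Tendsto (fun k => sk k i) Filter.atTop (nhds (s i))) :
    Filter.limsup (fun k => Rw w (sk k)) Filter.atTop ≤ Rw w s := by
  have hbdd : IsBoundedUnder (· ≥ ·) atTop fun k => Rw w (sk k) := by
    obtain ⟨B, hB⟩ := exists_le_Rw w (-∑ i, |s i| - 1)
    refine ⟨B, eventually_map.2 ?_⟩
    have h : ∀ᶠ k in atTop, ∀ i, s i - 1 < sk k i :=
      eventually_all.2 fun i => (hconv i).eventually_const_lt (sub_one_lt (s i))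
    filter_upwards [h] with k hk
    refine hB _ fun i => ?_
    have h2 : |s i| ≤ ∑ i, |s i| :=
      Finset.single_le_sum (f := fun i => |s i|) (fun _ _ => abs_nonneg _) (Finset.mem_univ i)
    linarith [hk i, neg_abs_le (s i)]
  refine le_of_forall_gt_imp_ge_of_dense fun c hc => ?_
  obtain ⟨r, hr, hrc⟩ := exists_rat_btwn hc
  obtain ⟨m, hm⟩ := exists_Rw_le_of_floor_le w s hr
  refine (limsup_le_of_le hbdd.isCoboundedUnder_le ?_ : _ ≤ (r : ℝ)).trans hrc.le
  have h : ∀ᶠ k in atTop, ∀ i, ∀ b ∈ Finset.range (m + 1), b * sk k i < ⌊b * s i⌋ + 1 :=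
    eventually_all.2 fun i => (Finset.eventually_all _).2 fun b _ =>
      ((hconv i).const_mul (b : ℝ)).eventually_lt_const (Int.lt_floor_add_one _)
  filter_upwards [h] with k hk
  refine hm _ fun i b hb => Int.lt_add_one_iff.1 (Int.floor_lt.2 ?_)
  exact_mod_cast hk i b (Finset.mem_range.2 (by omega))
end

section
/- Rationality of translation numbers from invariant ℤ-periodic finite sets: let f be a monotone map (a CircleDeg1Lift) and let X ⊆ ℝ be a nonempty set such that (i) x ∈ X if and only if x + 1 ∈ X, (ii) the image of X in ℝ/ℤ is finite (equivalently X ∩ [0,1) is finite), and (iii) f(X) ⊆ X. Then the translation number τ(f) is rational. -/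
open CircleDeg1Lift

theorem sub_intCast_mem_of_forall_mem_iff_add_one_mem {X : Set ℝ}
    (hper : ∀ x : ℝ, x ∈ X ↔ x + 1 ∈ X) {x : ℝ} (hx : x ∈ X) (n : ℤ) : x - n ∈ X := by
  induction n using Int.induction_on with
  | zero => simpa using hx
  | succ i ih =>
    rw [hper]
    convert ih using 1
    push_cast
    ring
  | pred i ih =>
    rw [hper] at ih
    convert ih using 1
    push_cast
    ring

/-- Rationality of translation numbers from invariant ℤ-periodic finite sets: if a
monotone map `f : CircleDeg1Lift` leaves invariant a nonempty set `X ⊆ ℝ` that is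
invariant under integer translation and whose image in `ℝ/ℤ` is finite (equivalently
`X ∩ [0,1)` is finite), then `τ(f)` is rational. -/
theorem translationNumber_rat_of_invariant_periodic_set (f : CircleDeg1Lift)
    (X : Set ℝ) (hne : X.Nonempty)
    (hper : ∀ x : ℝ, x ∈ X ↔ x + 1 ∈ X)
    (hfin : (X ∩ Set.Ico (0 : ℝ) 1).Finite)
    (hinv : f '' X ⊆ X) :
    ∃ r : ℚ, translationNumber f = r := by
  obtain ⟨x, hx⟩ := hne
  have h_orbit (n : ℕ) : f^[n] x ∈ X := (Set.mapsTo_iff_image_subset.2 hinv).iterate n hx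
  have h_fract (n : ℕ) : Int.fract (f^[n] x) ∈ X ∩ Set.Ico (0 : ℝ) 1 :=
    ⟨sub_intCast_mem_of_forall_mem_iff_add_one_mem hper (h_orbit n) _,
      Int.fract_nonneg _, Int.fract_lt_one _⟩
  obtain ⟨i, j, hij, h_eq⟩ := hfin.exists_lt_map_eq_of_forall_mem h_fract
  obtain ⟨m, hm⟩ := Int.fract_eq_fract.1 h_eq.symm
  have h_period : (f ^ (j - i)) (f^[i] x) = f^[i] x + m := by
    rw [coe_pow, ← Function.iterate_add_apply, Nat.sub_add_cancel hij.le]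
    linarith
  refine ⟨m / (j - i : ℕ), ?_⟩
  rw [translationNumber_of_map_pow_eq_add_int f h_period (Nat.sub_pos_of_lt hij)]
  push_cast
  rfl
end

section
/- Realization of the extremal product rotation number: for all integers p, k, q with q > 0, there exist f, g ∈ Homeo_ℤ(ℝ) with τ(f) = p/q, τ(g) = k/q, and τ(f∘g) = (p + k + 1)/q. -/
open CircleDeg1Lift

namespace CircleDeg1Lift

/-- Conjugation by the dilation `x ↦ q * x`: the map `f` is sent to `x ↦ f (q * x) / q`. -/
noncomputable def rescale (q : ℤ) (hq : 0 < q) : CircleDeg1Lift →* CircleDeg1Lift where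
  toFun f :=
    { toFun := fun x => f (q * x) / q
      monotone' := fun x y hxy => by
        have : (0 : ℝ) < q := by exact_mod_cast hq
        beta_reduce
        gcongr
      map_add_one' := fun x => by
        have : (q : ℝ) ≠ 0 := by exact_mod_cast hq.ne'
        rw [mul_add, mul_one, f.map_add_int]
        field_simp }
  map_one' := by
    have : (q : ℝ) ≠ 0 := by exact_mod_cast hq.ne'
    ext x
    simp [this]
  map_mul' f g := by
    have : (q : ℝ) ≠ 0 := by exact_mod_cast hq.ne'
    ext x
    change f (g (q * x)) / q = f (q * (g (q * x) / q)) / q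
    rw [mul_div_cancel₀ _ this]

theorem rescale_apply {q : ℤ} (hq : 0 < q) (f : CircleDeg1Lift) (x : ℝ) :
    rescale q hq f x = f (q * x) / q := rfl

theorem translationNumber_rescale {q : ℤ} (hq : 0 < q) (f : CircleDeg1Lift) :
    translationNumber (rescale q hq f) = translationNumber f / q := by
  refine translationNumber_eq_of_tendsto₀ _ ?_
  refine (f.tendsto_translation_number₀.div_const (q : ℝ)).congr fun n => ?_
  rw [← coe_pow, ← map_pow, rescale_apply, mul_zero, div_right_comm]

/-- The lift acting on each `[n, n + 1)` by the Möbius map `t ↦ 9 * t / (1 + 8 * t)`, which fixes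
the integers and pushes all other points forward. -/
noncomputable def mobiusPush : CircleDeg1Lift where
  toFun x := ⌊x⌋ + 9 * Int.fract x / (1 + 8 * Int.fract x)
  monotone' x y hxy := by
    have hx := Int.fract_nonneg x
    have hy := Int.fract_nonneg y
    have hx' := Int.fract_lt_one x
    rcases (Int.floor_mono hxy).eq_or_lt with h | h
    · have hf : Int.fract x ≤ Int.fract y := by
        unfold Int.fract; rw [h]; linarith
      beta_reduce
      rw [h]
      refine add_le_add_right ?_ _
      rw [div_le_div_iff₀ (by positivity) (by positivity)]
      nlinarith
    · have h1 : (⌊x⌋ : ℝ) + 1 ≤ ⌊y⌋ := by exact_mod_cast h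
      have h2 : 9 * Int.fract x / (1 + 8 * Int.fract x) ≤ 1 := by
        rw [div_le_one (by positivity)]; linarith
      have h3 : 0 ≤ 9 * Int.fract y / (1 + 8 * Int.fract y) := by positivity
      beta_reduce
      linarith
  map_add_one' x := by
    simp only [Int.floor_add_one, Int.fract_add_one]
    push_cast
    ring

theorem mobiusPush_int_add (n : ℤ) {t : ℝ} (h0 : 0 ≤ t) (h1 : t < 1) :
    mobiusPush (n + t) = n + 9 * t / (1 + 8 * t) := by
  have hf : ⌊t⌋ = 0 := Int.floor_eq_zero_iff.2 ⟨h0, h1⟩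
  change (⌊(n + t : ℝ)⌋ : ℝ) + 9 * Int.fract (n + t : ℝ) / (1 + 8 * Int.fract (n + t : ℝ)) = _
  rw [Int.floor_intCast_add, Int.fract_intCast_add, Int.fract_eq_self.2 ⟨h0, h1⟩, hf, add_zero]

theorem isUnit_mobiusPush : IsUnit mobiusPush := by
  refine isUnit_iff_bijective.2 ⟨fun x y hxy => ?_, fun y => ?_⟩
  · have hlt (t : ℝ) (ht : 0 ≤ t) (ht' : t < 1) : 9 * t / (1 + 8 * t) ∈ Set.Ico (0 : ℝ) 1 :=
      ⟨by positivity, by rw [div_lt_one (by positivity)]; linarith⟩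
    have hx0 := Int.fract_nonneg x
    have hy0 := Int.fract_nonneg y
    have hx1 := hlt _ hx0 (Int.fract_lt_one x)
    have hy1 := hlt _ hy0 (Int.fract_lt_one y)
    rw [← Int.floor_add_fract x, ← Int.floor_add_fract y,
      mobiusPush_int_add _ hx0 (Int.fract_lt_one x),
      mobiusPush_int_add _ hy0 (Int.fract_lt_one y)] at hxy
    have hfloor : ⌊x⌋ = ⌊y⌋ := by
      have := congrArg Int.floor hxy
      simpa only [Int.floor_intCast_add, Int.floor_eq_zero_iff.2 hx1,
        Int.floor_eq_zero_iff.2 hy1, add_zero] using this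
    rw [hfloor, add_right_inj, div_eq_div_iff (by positivity) (by positivity)] at hxy
    have hfract : Int.fract x = Int.fract y := by linarith
    rw [← Int.floor_add_fract x, ← Int.floor_add_fract y, hfloor, hfract]
  · have h0 := Int.fract_nonneg y
    have h1 := Int.fract_lt_one y
    have hd : 0 < 9 - 8 * Int.fract y := by linarith
    refine ⟨⌊y⌋ + Int.fract y / (9 - 8 * Int.fract y), ?_⟩
    rw [mobiusPush_int_add _ (by positivity) (by rw [div_lt_one hd]; linarith)]
    have hd' : 1 + 8 * (Int.fract y / (9 - 8 * Int.fract y)) = 9 / (9 - 8 * Int.fract y) := by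
      field_simp
      ring
    have hinv : 9 * (Int.fract y / (9 - 8 * Int.fract y)) / (9 / (9 - 8 * Int.fract y)) =
        Int.fract y := by
      rw [← mul_div_assoc, div_div_div_cancel_right₀ hd.ne', mul_div_cancel_left₀ _ (by norm_num)]
    rw [hd', hinv, Int.floor_add_fract]

end CircleDeg1Lift

/-- Realization of the extremal product rotation number: for integers `p, k, q` with
`q > 0` there exist `f, g ∈ Homeo_ℤ(ℝ)` with `τ(f) = p/q`, `τ(g) = k/q` and
`τ(f∘g) = (p+k+1)/q`. -/
theorem exists_product_translationNumber (p k q : ℤ) (hq : 0 < q) :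
    ∃ f g : CircleDeg1Liftˣ,
      translationNumber (f : CircleDeg1Lift) = (p : ℝ) / q ∧
      translationNumber (g : CircleDeg1Lift) = (k : ℝ) / q ∧
      translationNumber ((f * g : CircleDeg1Liftˣ) : CircleDeg1Lift) =
        ((p : ℝ) + k + 1) / q := by
  obtain ⟨a, ha⟩ := isUnit_mobiusPush
  have a0 : a.val 0 = 0 := by
    simpa [ha] using mobiusPush_int_add 0 (t := 0) le_rfl one_pos
  have a1 : a.val (1 / 4) = 3 / 4 := by
    rw [ha]
    convert mobiusPush_int_add 0 (t := 1 / 4) (by norm_num) (by norm_num) using 1 <;> norm_num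
  have aint (n : ℤ) (x : ℝ) : a.val (n + x) = n + a.val x := a.val.map_int_add n x
  let T (x : ℝ) : CircleDeg1Liftˣ := translate (Multiplicative.ofAdd x)
  have hT (x y : ℝ) : (T x).val y = x + y := translate_apply x y
  let f := T p * a
  let g := T (k + 1 / 2) * a * T (-(1 / 2))
  have hf : translationNumber f.val = p := by
    refine translationNumber_of_eq_add_int (x := 0) _ ?_
    simp [f, hT, a0]
  have hg : translationNumber g.val = k := by
    refine translationNumber_of_eq_add_int (x := 1 / 2) _ ?_
    simp only [g, Units.val_mul, mul_apply, hT]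
    norm_num [a0]
    ring
  have hfg : translationNumber (f * g).val = (p + k + 1 : ℤ) := by
    refine translationNumber_of_eq_add_int (x := 3 / 4) _ ?_
    simp only [f, g, Units.val_mul, mul_apply, hT]
    rw [show (-(1 / 2) + 3 / 4 : ℝ) = 1 / 4 by norm_num, a1,
      show (k + 1 / 2 + 3 / 4 : ℝ) = (k + 1 : ℤ) + 1 / 4 by push_cast; ring, aint, a1]
    push_cast
    ring
  refine ⟨Units.map (rescale q hq) f, Units.map (rescale q hq) g, ?_, ?_, ?_⟩
  · rw [Units.coe_map, translationNumber_rescale, hf]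
  · rw [Units.coe_map, translationNumber_rescale, hg]
  · rw [← map_mul, Units.coe_map, translationNumber_rescale, hfg]
    push_cast
    rfl
end

section
/- Commutator rotation numbers, irrational case: let f, g ∈ Homeo_ℤ(ℝ). If τ(f) is irrational or τ(g) is irrational, then τ([f,g]) = 0, where [f,g] = f∘g∘f⁻¹∘g⁻¹. -/
open CircleDeg1Lift

/-- Positive multiples of an irrational number approximate integers from below. -/
theorem Irrational.exists_int_sub_nat_mul_mem_Ioo {a : ℝ} (ha : Irrational a) {ε : ℝ}
    (hε : 0 < ε) : ∃ (n : ℕ) (m : ℤ), 0 < n ∧ (m - n * a : ℝ) ∈ Set.Ioo 0 ε := by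
  have : Fact ((0 : ℝ) < 1) := ⟨one_pos⟩
  have hdense : DenseRange (fun n : ℕ => n • (a : AddCircle (1 : ℝ))) := by
    rw [← denseRange_zsmul_iff_nsmul, AddCircle.denseRange_zsmul_coe_iff, div_one]
    exact ha
  have hopen : IsOpen ((fun x : ℝ => (x : AddCircle (1 : ℝ))) '' Set.Ioo (-min ε 1) 0) :=
    QuotientAddGroup.isOpenMap_coe _ isOpen_Ioo
  obtain ⟨n, y, ⟨hy, hy0⟩, hyn⟩ := hdense.exists_mem_open hopen
    ((Set.nonempty_Ioo.2 (neg_lt_zero.2 (lt_min hε one_pos))).image _)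
  obtain ⟨m, hm⟩ : ∃ m : ℤ, m - n * a = -y := by
    have hsub : ((n * a - y : ℝ) : AddCircle (1 : ℝ)) = 0 := by
      rw [AddCircle.coe_sub, ← nsmul_eq_mul, AddCircle.coe_nsmul, sub_eq_zero]
      exact hyn.symm
    obtain ⟨m, hm⟩ := (AddCircle.coe_eq_zero_iff 1).1 hsub
    rw [zsmul_one] at hm
    exact ⟨m, by linarith⟩
  refine ⟨n, m, Nat.pos_of_ne_zero ?_, by linarith, by linarith [min_le_left ε 1]⟩
  rintro rfl
  have h0 : (0 : ℝ) < m := by simp at hm; linarith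
  have h1 : (m : ℝ) < 1 := by simp at hm; linarith [min_le_right ε 1]
  norm_cast at h0 h1
  lia

namespace CircleDeg1Lift

theorem exists_pos_forall_add_le_map {c : CircleDeg1Lift} (hc : Continuous c)
    (h : ∀ x, x < c x) : ∃ ε > 0, ∀ x, x + ε ≤ c x := by
  obtain ⟨x, -, hx⟩ : ∃ x ∈ Set.Icc (0 : ℝ) 1, ∀ y ∈ Set.Icc (0 : ℝ) 1, c x - x ≤ c y - y :=
    isCompact_Icc.exists_isMinOn (Set.nonempty_Icc.2 zero_le_one)
      (hc.sub continuous_id).continuousOn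
  refine ⟨c x - x, sub_pos.2 (h x), fun y => ?_⟩
  linarith [c.forall_map_sub_of_Icc (fun a => c x - x ≤ a) hx y]

/-- The translation number is strictly monotone at irrational values. -/
theorem translationNumber_lt_translationNumber_mul {c k : CircleDeg1Lift} (hc : Continuous c)
    (h : ∀ x, x < c x) (hk : Irrational (translationNumber k)) :
    translationNumber k < translationNumber (c * k) := by
  obtain ⟨ε, hε, hcε⟩ := exists_pos_forall_add_le_map hc h
  obtain ⟨n, m, hn, hm0, hmε⟩ := hk.exists_int_sub_nat_mul_mem_Ioo hε
  obtain ⟨x, hx⟩ : ∃ x, x + (m - ε) < (k ^ n) x := by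
    by_contra! H
    have := translationNumber_le_of_le_add _ H
    rw [translationNumber_pow] at this
    linarith
  have hle : k ≤ c * k := fun y => (h (k y)).le
  have hpow : (k ^ n) x + ε ≤ ((c * k) ^ n) x := by
    obtain ⟨j, rfl⟩ := Nat.exists_eq_succ_of_ne_zero hn.ne'
    rw [pow_succ' k, pow_succ' (c * k)]
    calc k ((k ^ j) x) + ε ≤ k (((c * k) ^ j) x) + ε := by
          gcongr
          exact pow_mono hle j x
      _ ≤ c (k (((c * k) ^ j) x)) := hcε _
  have hm : (m : ℝ) ≤ translationNumber ((c * k) ^ n) :=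
    le_translationNumber_of_add_int_le _ (x := x) (by linarith)
  rw [translationNumber_pow] at hm
  exact lt_of_mul_lt_mul_left (by linarith : (n : ℝ) * translationNumber k < _) n.cast_nonneg

theorem units_continuous (f : CircleDeg1Liftˣ) : Continuous (f : CircleDeg1Lift) :=
  (toOrderIso f).continuous

theorem translationNumber_mul_inv_nonpos_of_irrational {u v : CircleDeg1Liftˣ}
    (huv : translationNumber u = translationNumber v)
    (hv : Irrational (translationNumber (v : CircleDeg1Lift))) :
    translationNumber ((u * v⁻¹ : CircleDeg1Liftˣ) : CircleDeg1Lift) ≤ 0 := by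
  by_contra! H
  have hlt := translationNumber_lt_translationNumber_mul (units_continuous (u * v⁻¹))
    (fun x => by
      simpa using lt_map_of_int_lt_translationNumber ((u * v⁻¹ : CircleDeg1Liftˣ) : CircleDeg1Lift)
        (n := 0) (by rwa [Int.cast_zero]) x) hv
  rw [← Units.val_mul, inv_mul_cancel_right] at hlt
  exact hlt.ne' huv

theorem translationNumber_mul_inv_eq_zero_of_irrational {u v : CircleDeg1Liftˣ}
    (huv : translationNumber u = translationNumber v)
    (hv : Irrational (translationNumber (v : CircleDeg1Lift))) :
    translationNumber ((u * v⁻¹ : CircleDeg1Liftˣ) : CircleDeg1Lift) = 0 := by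
  refine (translationNumber_mul_inv_nonpos_of_irrational huv hv).antisymm ?_
  have h := translationNumber_mul_inv_nonpos_of_irrational huv.symm (huv ▸ hv)
  rwa [← inv_inv (v * u⁻¹), translationNumber_units_inv, mul_inv_rev, inv_inv,
    neg_nonpos] at h

end CircleDeg1Lift

/-- Commutator rotation numbers, irrational case: if `τ(f)` or `τ(g)` is irrational,
then the commutator `[f,g] = f∘g∘f⁻¹∘g⁻¹` has translation number zero. -/
theorem translationNumber_commutator_eq_zero_of_irrational (f g : CircleDeg1Liftˣ)
    (h : Irrational (translationNumber (f : CircleDeg1Lift)) ∨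
      Irrational (translationNumber (g : CircleDeg1Lift))) :
    translationNumber ((f * g * f⁻¹ * g⁻¹ : CircleDeg1Liftˣ) : CircleDeg1Lift) = 0 := by
  rcases h with hf | hg
  · have hconj : translationNumber ((g * f * g⁻¹ : CircleDeg1Liftˣ) : CircleDeg1Lift) =
        translationNumber f := by simp
    rw [show f * g * f⁻¹ * g⁻¹ = f * (g * f * g⁻¹)⁻¹ by group]
    exact translationNumber_mul_inv_eq_zero_of_irrational hconj.symm (hconj ▸ hf)
  · exact translationNumber_mul_inv_eq_zero_of_irrational (by simp) hg
end
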